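/- arXiv:2103.04886 — 2 statements merged into one kernel-verified Lean document; each statement's English description precedes it below -/
import Mathlib

section
/- Let α ≥ 0, let g̃ : ℝ^{d×n} → ℝ^{m×n} and c : ℝ^{d×n} → ℝ be differentiable with c(X) > 0 for all X, and define the normalized score g(X) = g̃(X)/c(X) and the attention map Att(X) = X · softmax(g(X))ᵀ ∈ ℝ^{d×m}. Suppose that for all X ∈ ℝ^{d×n} and all H ∈ ℝ^{d×n}: (1) ‖g̃(X)‖_∞ ≤ α c(X), where ‖·‖_∞ is the maximum absolute value of the entries; (2) ‖Xᵀ‖_{(∞,2)} · ‖Dg̃_X(H)‖_{(2,∞)} ≤ α c(X) ‖H‖_F; and (3) ‖Xᵀ‖_{(∞,2)} · |Dc_X(H)| · ‖g̃(X)‖_{(2,∞)} ≤ α c(X)² ‖H‖_F. Then Att is Lipschitz continuous with respect to the Frobenius norm and L_F(Att) ≤ e^α √(m/n) + α√8, i.e. for all X, Y ∈ ℝ^{d×n}, ‖Att(X) − Att(Y)‖_F ≤ (e^α √(m/n) + α√8) ‖X − Y‖_F. -/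
open scoped BigOperators Matrix

/-- Frobenius norm of a real matrix. -/
noncomputable def frobNorm {α β : Type*} [Fintype α] [Fintype β] (M : Matrix α β ℝ) : ℝ :=
  Real.sqrt (∑ i, ∑ j, (M i j) ^ 2)

/-- Row-wise softmax of a real matrix. -/
noncomputable def softmaxM {α β : Type*} [Fintype α] [Fintype β] (M : Matrix α β ℝ) :
    Matrix α β ℝ :=
  Matrix.of fun i j => Real.exp (M i j) / ∑ k, Real.exp (M i k)

/-- The `(∞,2)`-norm of a matrix: the maximum Euclidean norm of its rows. -/
noncomputable def normInf2 {α β : Type*} [Fintype α] [Fintype β] (M : Matrix α β ℝ) : ℝ :=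
  ⨆ i, Real.sqrt (∑ j, (M i j) ^ 2)

/-- The `(2,∞)`-norm of a matrix: the ℓ2 norm of the vector of row-wise maxima (in abs. value). -/
noncomputable def norm2Inf {α β : Type*} [Fintype α] [Fintype β] (M : Matrix α β ℝ) : ℝ :=
  Real.sqrt (∑ i, (⨆ j, |M i j|) ^ 2)

attribute [local instance]
  Matrix.frobeniusSeminormedAddCommGroup Matrix.frobeniusNormedAddCommGroup
  Matrix.frobeniusNormedSpace


theorem aux_frob_cs {α β : Type*} [Fintype α] [Fintype β] (D M : Matrix α β ℝ) :
    ∑ i, ∑ j, D i j * M i j ≤ frobNorm D * frobNorm M := by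
  unfold frobNorm
  simp only [← Fintype.sum_prod_type']
  exact Real.sum_mul_le_sqrt_mul_sqrt Finset.univ
    (fun x : α × β => D x.1 x.2) (fun x => M x.1 x.2)

theorem aux_frob_sq {α β : Type*} [Fintype α] [Fintype β] (D : Matrix α β ℝ) :
    frobNorm D ^ 2 = ∑ i, ∑ j, (D i j) ^ 2 := by
  unfold frobNorm
  exact Real.sq_sqrt (Finset.sum_nonneg fun i _ => Finset.sum_nonneg fun j _ => sq_nonneg _)

theorem aux_frob_nonneg {α β : Type*} [Fintype α] [Fintype β] (D : Matrix α β ℝ) :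
    0 ≤ frobNorm D := Real.sqrt_nonneg _

/-- weighted Cauchy-Schwarz -/
theorem aux_wcs {β : Type*} [Fintype β] (a x q : β → ℝ) (ha : ∀ j, 0 ≤ a j) :
    (∑ j, x j * (a j * q j)) ^ 2 ≤ (∑ j, a j * x j ^ 2) * ∑ j, a j * q j ^ 2 := by
  apply Finset.sum_sq_le_sum_mul_sum_of_sq_eq_mul
  · intro i _; exact mul_nonneg (ha i) (sq_nonneg _)
  · intro i _; exact mul_nonneg (ha i) (sq_nonneg _)
  · intro i _; ring

theorem aux_first {d n m : ℕ} (H : Matrix (Fin d) (Fin n) ℝ) (A : Matrix (Fin m) (Fin n) ℝ)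
    (K : ℝ) (hA : ∀ i j, 0 ≤ A i j) (hs : ∀ i, ∑ j, A i j = 1) (hK : ∀ i j, A i j ≤ K) :
    frobNorm (H * Aᵀ) ^ 2 ≤ (m * K) * frobNorm H ^ 2 := by
  rw [aux_frob_sq, aux_frob_sq]
  have h : ∀ l i, ((H * Aᵀ) l i) ^ 2 ≤ ∑ j, K * H l j ^ 2 := by
    intro l i
    have := aux_wcs (A i) (H l) (fun _ => 1) (hA i)
    simp only [mul_one, one_pow, hs] at this
    rw [Matrix.mul_apply]
    refine this.trans (Finset.sum_le_sum fun j _ => ?_)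
    exact mul_le_mul_of_nonneg_right (hK i j) (sq_nonneg _)
  refine (Finset.sum_le_sum fun l _ => Finset.sum_le_sum fun i _ => h l i).trans (le_of_eq ?_)
  simp only [Finset.sum_const, Finset.card_univ, Fintype.card_fin, nsmul_eq_mul, ← Finset.mul_sum]
  ring

theorem aux_var {n : ℕ} (a p : Fin n → ℝ) (s : ℝ) (ha : ∀ j, 0 ≤ a j) (hs : ∑ j, a j = 1)
    (hp : ∀ j, |p j| ≤ s) : ∑ j, a j * (p j - ∑ k, a k * p k) ^ 2 ≤ s ^ 2 := by
  set b := ∑ k, a k * p k with hb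
  have e : ∑ j, a j * (p j - b) ^ 2 = ∑ j, a j * p j ^ 2 - b ^ 2 := by
    have : ∀ j, a j * (p j - b) ^ 2 = a j * p j ^ 2 - (2 * b) * (a j * p j) + b ^ 2 * a j := by
      intro j; ring
    simp only [this, Finset.sum_add_distrib, Finset.sum_sub_distrib, ← Finset.mul_sum, hs, ← hb]
    ring
  have e2 : ∑ j, a j * p j ^ 2 ≤ ∑ j, a j * s ^ 2 := by
    refine Finset.sum_le_sum fun j _ => mul_le_mul_of_nonneg_left ?_ (ha j)
    exact sq_le_sq' (abs_le.1 (hp j)).1 (abs_le.1 (hp j)).2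
  rw [← Finset.sum_mul, hs, one_mul] at e2
  nlinarith [sq_nonneg b]

theorem aux_second {d n m : ℕ} (X : Matrix (Fin d) (Fin n) ℝ) (A p : Matrix (Fin m) (Fin n) ℝ)
    (s : Fin m → ℝ) (hA : ∀ i j, 0 ≤ A i j) (hs : ∀ i, ∑ j, A i j = 1)
    (hp : ∀ i j, |p i j| ≤ s i) :
    frobNorm (X * (Matrix.of fun i j => A i j * (p i j - ∑ k, A i k * p i k))ᵀ) ^ 2
      ≤ normInf2 Xᵀ ^ 2 * ∑ i, s i ^ 2 := by
  rw [aux_frob_sq, Finset.sum_comm, Finset.mul_sum]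
  refine Finset.sum_le_sum fun i _ => ?_
  have h : ∀ l, (X * (Matrix.of fun i j => A i j * (p i j - ∑ k, A i k * p i k))ᵀ) l i ^ 2 ≤
      (∑ j, A i j * X l j ^ 2) * s i ^ 2 := by
    intro l
    rw [Matrix.mul_apply]
    refine (aux_wcs (A i) (X l) (fun j => p i j - ∑ k, A i k * p i k) (hA i)).trans ?_
    refine mul_le_mul_of_nonneg_left (aux_var _ _ _ (hA i) (hs i) (hp i)) ?_
    exact Finset.sum_nonneg fun j _ => mul_nonneg (hA i j) (sq_nonneg _)
  refine (Finset.sum_le_sum fun l _ => h l).trans ?_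
  rw [← Finset.sum_mul]
  refine mul_le_mul_of_nonneg_right ?_ (sq_nonneg _)
  rw [Finset.sum_comm]
  calc ∑ j, ∑ l, A i j * X l j ^ 2 ≤ ∑ j, A i j * normInf2 Xᵀ ^ 2 := by
        refine Finset.sum_le_sum fun j _ => ?_
        rw [← Finset.mul_sum]
        refine mul_le_mul_of_nonneg_left ?_ (hA i j)
        have h0 : Real.sqrt (∑ l, Xᵀ j l ^ 2) ≤ normInf2 Xᵀ :=
          le_ciSup (f := fun j => Real.sqrt (∑ l, Xᵀ j l ^ 2)) (Set.finite_range _).bddAbove j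
        have h1 := pow_le_pow_left₀ (Real.sqrt_nonneg _) h0 2
        rwa [Real.sq_sqrt (Finset.sum_nonneg fun _ _ => sq_nonneg _)] at h1
    _ = normInf2 Xᵀ ^ 2 := by rw [← Finset.sum_mul, hs, one_mul]

theorem aux_norm2Inf_sq {m n : ℕ} (M : Matrix (Fin m) (Fin n) ℝ) :
    norm2Inf M ^ 2 = ∑ i, (⨆ j, |M i j|) ^ 2 :=
  Real.sq_sqrt (Finset.sum_nonneg fun _ _ => sq_nonneg _)

theorem aux_le_sup {m n : ℕ} (M : Matrix (Fin m) (Fin n) ℝ) (i : Fin m) (j : Fin n) :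
    |M i j| ≤ ⨆ j, |M i j| :=
  le_ciSup (f := fun j => |M i j|) (Set.finite_range _).bddAbove j

/-- bound for the derivative of the score -/
theorem aux_score {m n : ℕ} (U V : Matrix (Fin m) (Fin n) ℝ) (R α F c e : ℝ) (hc : 0 < c)
    (hR : 0 ≤ R) (hF : 0 ≤ F) (hα : 0 ≤ α)
    (h2 : R * norm2Inf U ≤ α * c * F) (h3 : R * |e| * norm2Inf V ≤ α * c ^ 2 * F) :
    R ^ 2 * ∑ i, (c⁻¹ * (⨆ j, |U i j|) + (c ^ 2)⁻¹ * |e| * (⨆ j, |V i j|)) ^ 2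
      ≤ (2 * α * F) ^ 2 := by
  have hU : (R * norm2Inf U) ^ 2 ≤ (α * c * F) ^ 2 :=
    pow_le_pow_left₀ (mul_nonneg hR (Real.sqrt_nonneg _)) h2 2
  have hV : (R * |e| * norm2Inf V) ^ 2 ≤ (α * c ^ 2 * F) ^ 2 :=
    pow_le_pow_left₀ (mul_nonneg (mul_nonneg hR (abs_nonneg _)) (Real.sqrt_nonneg _)) h3 2
  rw [mul_pow, aux_norm2Inf_sq] at hU hV
  have hs : ∑ i, (c⁻¹ * (⨆ j, |U i j|) + (c ^ 2)⁻¹ * |e| * (⨆ j, |V i j|)) ^ 2 ≤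
      2 * (c⁻¹) ^ 2 * ∑ i, (⨆ j, |U i j|) ^ 2
        + 2 * ((c ^ 2)⁻¹ * |e|) ^ 2 * ∑ i, (⨆ j, |V i j|) ^ 2 := by
    rw [Finset.mul_sum, Finset.mul_sum, ← Finset.sum_add_distrib]
    refine Finset.sum_le_sum fun i _ => ?_
    nlinarith [sq_nonneg (c⁻¹ * (⨆ j, |U i j|) - (c ^ 2)⁻¹ * |e| * (⨆ j, |V i j|))]
  refine (mul_le_mul_of_nonneg_left hs (sq_nonneg R)).trans ?_
  have h4 := mul_le_mul_of_nonneg_left hU (by positivity : 0 ≤ 2 * (c⁻¹) ^ 2)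
  have h5 := mul_le_mul_of_nonneg_left hV (by positivity : 0 ≤ 2 * ((c ^ 2)⁻¹) ^ 2)
  have e4 : 2 * (c⁻¹) ^ 2 * (α * c * F) ^ 2 = 2 * (α * F) ^ 2 := by field_simp
  have e5 : 2 * ((c ^ 2)⁻¹) ^ 2 * (α * c ^ 2 * F) ^ 2 = 2 * (α * F) ^ 2 := by field_simp
  rw [e4] at h4
  rw [e5] at h5
  nlinarith

theorem aux_softmax_nonneg {m n : ℕ} (M : Matrix (Fin m) (Fin n) ℝ) (i : Fin m) (j : Fin n) :
    0 ≤ softmaxM M i j := by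
  simp only [softmaxM, Matrix.of_apply]
  exact div_nonneg (Real.exp_pos _).le (Finset.sum_nonneg fun _ _ => (Real.exp_pos _).le)

theorem aux_expsum_pos {n : ℕ} (hn : 0 < n) (v : Fin n → ℝ) : 0 < ∑ k, Real.exp (v k) := by
  haveI : Nonempty (Fin n) := ⟨⟨0, hn⟩⟩
  exact Finset.sum_pos (fun _ _ => Real.exp_pos _) Finset.univ_nonempty

theorem aux_softmax_sum {m n : ℕ} (hn : 0 < n) (M : Matrix (Fin m) (Fin n) ℝ) (i : Fin m) :
    ∑ j, softmaxM M i j = 1 := by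
  simp only [softmaxM, Matrix.of_apply]
  rw [← Finset.sum_div]
  exact div_self (aux_expsum_pos hn _).ne'

theorem aux_softmax_le {m n : ℕ} (hn : 0 < n) (M : Matrix (Fin m) (Fin n) ℝ) (α : ℝ)
    (h : ∀ i j, |M i j| ≤ α) (i : Fin m) (j : Fin n) :
    softmaxM M i j ≤ Real.exp α ^ 2 / n := by
  simp only [softmaxM, Matrix.of_apply]
  have hn' : (0 : ℝ) < n := by exact_mod_cast hn
  rw [div_le_div_iff₀ (aux_expsum_pos hn _) hn']
  have h1 : Real.exp (M i j) ≤ Real.exp α := Real.exp_le_exp.2 (abs_le.1 (h i j)).2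
  have h2 : (n : ℝ) * Real.exp (-α) ≤ ∑ k, Real.exp (M i k) := by
    have := Finset.card_nsmul_le_sum Finset.univ (fun k => Real.exp (M i k)) (Real.exp (-α))
      (fun k _ => Real.exp_le_exp.2 (abs_le.1 (h i k)).1)
    simpa using this
  calc Real.exp (M i j) * n ≤ Real.exp α * n := by gcongr
    _ = Real.exp α ^ 2 * (n * Real.exp (-α)) := by
        rw [Real.exp_neg]; field_simp
    _ ≤ _ := by gcongr

theorem aux_softmax_deriv {m n : ℕ} (hn : 0 < n) (G : ℝ → Matrix (Fin m) (Fin n) ℝ)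
    (p : Matrix (Fin m) (Fin n) ℝ) (t : ℝ)
    (hG : ∀ i j, HasDerivAt (fun t => G t i j) (p i j) t) (i : Fin m) (j : Fin n) :
    HasDerivAt (fun t => softmaxM (G t) i j)
      (softmaxM (G t) i j * (p i j - ∑ k, softmaxM (G t) i k * p i k)) t := by
  have hpos := aux_expsum_pos hn (fun k => G t i k)
  have h1 := (hG i j).exp.div (HasDerivAt.fun_sum (u := Finset.univ) fun k _ => (hG i k).exp) hpos.ne'
  refine HasDerivAt.congr_deriv (f := fun t => softmaxM (G t) i j) h1 ?_
  simp only [softmaxM, Matrix.of_apply]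
  have e : ∑ k, Real.exp (G t i k) / (∑ k, Real.exp (G t i k)) * p i k =
      (∑ k, Real.exp (G t i k) * p i k) / (∑ k, Real.exp (G t i k)) := by
    rw [Finset.sum_div]
    exact Finset.sum_congr rfl fun k _ => by ring
  rw [e]
  field_simp

/-- **Theorem: general case.** Let `α ≥ 0`, let `g̃` and `c > 0` be
differentiable, and let `g(X) = g̃(X)/c(X)`, `Att(X) = X ⬝ softmax(g(X))ᵀ`. If for all `X, H`:
(1) every entry of `g̃(X)` is bounded by `α c(X)`;
(2) `‖Xᵀ‖_{(∞,2)} ⬝ ‖Dg̃_X(H)‖_{(2,∞)} ≤ α c(X) ‖H‖_F`;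
(3) `‖Xᵀ‖_{(∞,2)} ⬝ |Dc_X(H)| ⬝ ‖g̃(X)‖_{(2,∞)} ≤ α c(X)² ‖H‖_F`;
then `Att` is Lipschitz for the Frobenius norm with constant `e^α √(m/n) + α√8`. -/
theorem attention_lipschitz_general_case {d n m : ℕ}
    (α : ℝ) (hα : 0 ≤ α)
    (gt : Matrix (Fin d) (Fin n) ℝ → Matrix (Fin m) (Fin n) ℝ)
    (c : Matrix (Fin d) (Fin n) ℝ → ℝ)
    (hgt : Differentiable ℝ gt) (hc : Differentiable ℝ c)
    (hcpos : ∀ X, 0 < c X)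
    (h1 : ∀ X i j, |gt X i j| ≤ α * c X)
    (h2 : ∀ X H, normInf2 Xᵀ * norm2Inf (fderiv ℝ gt X H) ≤ α * c X * frobNorm H)
    (h3 : ∀ X H, normInf2 Xᵀ * |fderiv ℝ c X H| * norm2Inf (gt X) ≤ α * (c X) ^ 2 * frobNorm H) :
    ∀ X Y : Matrix (Fin d) (Fin n) ℝ,
      frobNorm (X * (softmaxM ((c X)⁻¹ • gt X))ᵀ - Y * (softmaxM ((c Y)⁻¹ • gt Y))ᵀ) ≤
        (Real.exp α * Real.sqrt ((m : ℝ) / n) + α * Real.sqrt 8) * frobNorm (X - Y) := by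
  intro X Y
  rcases Nat.eq_zero_or_pos n with hn | hn
  · subst hn
    have hXY : X = Y := by ext i j; exact j.elim0
    subst hXY
    simp [frobNorm]
  have hn' : (0 : ℝ) < n := by exact_mod_cast hn
  set H := X - Y with hH
  set γ : ℝ → Matrix (Fin d) (Fin n) ℝ := fun t => Y + t • H with hγ
  have hγd : ∀ t, HasDerivAt γ H t := by
    intro t
    have h := ((hasDerivAt_id t).smul_const H).const_add Y
    rw [one_smul] at h
    exact h
  set A : ℝ → Matrix (Fin m) (Fin n) ℝ := fun t => softmaxM ((c (γ t))⁻¹ • gt (γ t)) with hA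
  set p : ℝ → Matrix (Fin m) (Fin n) ℝ := fun t => Matrix.of fun i j =>
    (c (γ t))⁻¹ * fderiv ℝ gt (γ t) H i j
      - (c (γ t) ^ 2)⁻¹ * fderiv ℝ c (γ t) H * gt (γ t) i j with hp
  set B : ℝ → Matrix (Fin m) (Fin n) ℝ := fun t => Matrix.of fun i j =>
    A t i j * (p t i j - ∑ k, A t i k * p t i k) with hB
  have hcd : ∀ t, HasDerivAt (fun t => c (γ t)) (fderiv ℝ c (γ t) H) t := fun t =>
    (hc (γ t)).hasFDerivAt.comp_hasDerivAt t (hγd t)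
  have hgd : ∀ t i j, HasDerivAt (fun t => gt (γ t) i j) (fderiv ℝ gt (γ t) H i j) t := by
    intro t i j
    have h := (hgt (γ t)).hasFDerivAt.comp_hasDerivAt t (hγd t)
    let φ : Matrix (Fin m) (Fin n) ℝ →L[ℝ] ℝ :=
      LinearMap.toContinuousLinearMap (Matrix.entryLinearMap ℝ ℝ i j)
    exact φ.hasFDerivAt.comp_hasDerivAt t h
  have hγe : ∀ t l j, HasDerivAt (fun t => γ t l j) (H l j) t := by
    intro t l j
    have := ((hasDerivAt_id t).mul_const (H l j)).const_add (Y l j)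
    simpa [hγ] using this
  have hAd : ∀ t i j, HasDerivAt (fun t => A t i j) (B t i j) t := by
    intro t i j
    refine aux_softmax_deriv hn (fun t => (c (γ t))⁻¹ • gt (γ t)) (p t) t ?_ i j
    intro i j
    have h := ((hcd t).inv (hcpos _).ne').mul (hgd t i j)
    refine HasDerivAt.congr_deriv (f := fun t => ((c (γ t))⁻¹ • gt (γ t)) i j) h ?_
    simp only [hp, Matrix.of_apply, Pi.inv_apply]
    field_simp
    ring
  set D := X * (softmaxM ((c X)⁻¹ • gt X))ᵀ - Y * (softmaxM ((c Y)⁻¹ • gt Y))ᵀ with hD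
  set L := Real.exp α * Real.sqrt ((m : ℝ) / n) + α * Real.sqrt 8 with hL
  have hφ : ∀ t, HasDerivAt (fun t => ∑ l, ∑ i, D l i * (γ t * (A t)ᵀ) l i)
      (∑ l, ∑ i, D l i * (H * (A t)ᵀ + γ t * (B t)ᵀ) l i) t := by
    intro t
    refine HasDerivAt.fun_sum fun l _ => HasDerivAt.fun_sum fun i _ => HasDerivAt.const_mul _ ?_
    simp only [Matrix.add_apply, Matrix.mul_apply, Matrix.transpose_apply, ← Finset.sum_add_distrib]
    exact HasDerivAt.fun_sum fun j _ => (hγe t l j).mul (hAd t i j)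
  have hbound : ∀ t, ∑ l, ∑ i, D l i * (H * (A t)ᵀ + γ t * (B t)ᵀ) l i
      ≤ frobNorm D * (L * frobNorm H) := by
    intro t
    have hF := aux_frob_nonneg H
    have hA0 : ∀ i j, 0 ≤ A t i j := fun i j => aux_softmax_nonneg _ i j
    have hA1 : ∀ i, ∑ j, A t i j = 1 := fun i => aux_softmax_sum hn _ i
    have hAK : ∀ i j, A t i j ≤ Real.exp α ^ 2 / n := by
      refine fun i j => aux_softmax_le hn _ α (fun i j => ?_) i j
      rw [Matrix.smul_apply, smul_eq_mul, abs_mul, abs_of_pos (inv_pos.2 (hcpos _)),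
        inv_mul_le_iff₀ (hcpos _), mul_comm]
      exact h1 _ i j
    have b1 : frobNorm (H * (A t)ᵀ) ≤ Real.exp α * Real.sqrt ((m : ℝ) / n) * frobNorm H := by
      refine (abs_le_of_sq_le_sq' ?_ (by positivity)).2
      refine (aux_first H (A t) _ hA0 hA1 hAK).trans (le_of_eq ?_)
      rw [mul_pow, mul_pow, Real.sq_sqrt (by positivity)]
      ring
    have hR : 0 ≤ normInf2 (γ t)ᵀ := Real.iSup_nonneg fun _ => Real.sqrt_nonneg _
    have b2 : frobNorm (γ t * (B t)ᵀ) ≤ 2 * α * frobNorm H := by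
      refine (abs_le_of_sq_le_sq' ?_ (by positivity)).2
      refine (aux_second (γ t) (A t) (p t) (fun i =>
        (c (γ t))⁻¹ * (⨆ j, |fderiv ℝ gt (γ t) H i j|)
          + (c (γ t) ^ 2)⁻¹ * |fderiv ℝ c (γ t) H| * (⨆ j, |gt (γ t) i j|)) hA0 hA1 ?_).trans
        (aux_score _ _ _ α _ _ _ (hcpos _) hR hF hα (h2 _ H) (h3 _ H))
      intro i j
      have hci := inv_pos.2 (hcpos (γ t))
      have hci2 := inv_pos.2 (pow_pos (hcpos (γ t)) 2)
      simp only [hp, Matrix.of_apply]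
      refine (norm_sub_le (E := ℝ) _ _).trans (add_le_add ?_ ?_)
      · rw [Real.norm_eq_abs, abs_mul, abs_of_pos hci]
        exact mul_le_mul_of_nonneg_left (aux_le_sup _ i j) hci.le
      · rw [Real.norm_eq_abs, abs_mul, abs_mul, abs_of_pos hci2]
        exact mul_le_mul_of_nonneg_left (aux_le_sup _ i j) (by positivity)
    have h8 : 2 ≤ Real.sqrt 8 := Real.le_sqrt_of_sq_le (by norm_num)
    have c1 := aux_frob_cs D (H * (A t)ᵀ)
    have c2 := aux_frob_cs D (γ t * (B t)ᵀ)
    have hDn := aux_frob_nonneg D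
    simp only [Matrix.add_apply, mul_add, Finset.sum_add_distrib]
    have b3 : 2 * α * frobNorm H ≤ α * Real.sqrt 8 * frobNorm H := by
      refine mul_le_mul_of_nonneg_right ?_ hF
      nlinarith
    calc _ ≤ frobNorm D * frobNorm (H * (A t)ᵀ) + frobNorm D * frobNorm (γ t * (B t)ᵀ) :=
          add_le_add c1 c2
      _ = frobNorm D * (frobNorm (H * (A t)ᵀ) + frobNorm (γ t * (B t)ᵀ)) := by ring
      _ ≤ frobNorm D * (L * frobNorm H) := by
          refine mul_le_mul_of_nonneg_left ?_ hDn
          rw [hL, add_mul]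
          linarith
  obtain ⟨t, -, ht⟩ := exists_hasDerivAt_eq_slope _ _ (zero_lt_one' ℝ)
    (fun t _ => (hφ t).continuousAt.continuousWithinAt) (fun t _ => hφ t)
  have hb := hbound t
  rw [ht] at hb
  have g1 : γ 1 = X := by simp [hγ, hH]
  have g0 : γ 0 = Y := by simp [hγ]
  have hsq : ∑ l, ∑ i, D l i * (γ 1 * (A 1)ᵀ) l i - ∑ l, ∑ i, D l i * (γ 0 * (A 0)ᵀ) l i
      = frobNorm D ^ 2 := by
    rw [aux_frob_sq]
    simp only [← Finset.sum_sub_distrib, hA, g1, g0]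
    refine Finset.sum_congr rfl fun l _ => Finset.sum_congr rfl fun i _ => ?_
    rw [← mul_sub, ← Matrix.sub_apply, ← hD, sq]
  rw [hsq, sub_zero, div_one, sq] at hb
  rcases (aux_frob_nonneg D).eq_or_lt with h0 | h0
  · rw [← h0]
    have := aux_frob_nonneg H
    positivity
  · exact le_of_mul_le_mul_left hb h0
end

section
/- Let α ≥ 0 and let g̃ : ℝ^{d×n} → ℝ^{m×n} be a differentiable map that is Lipschitz continuous from the Frobenius norm to the (2,∞)-norm with Lipschitz constant L = L_{F,(2,∞)}(g̃) > 0. Define the LipschitzNorm-normalized score g(X) = α g̃(X) / max{ ‖g̃(X)‖_{(2,∞)}, ‖Xᵀ‖_{(∞,2)} · L } (assuming the denominator max{‖g̃(X)‖_{(2,∞)}, ‖Xᵀ‖_{(∞,2)} L} is strictly positive for all X in the domain considered), and let Att(X) = X · softmax(g(X))ᵀ. Then Att is Lipschitz continuous with respect to the Frobenius norm and L_F(Att) ≤ e^α √(m/n) + α√8. -/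
open scoped BigOperators Matrix

attribute [local instance]
  Matrix.frobeniusSeminormedAddCommGroup Matrix.frobeniusNormedAddCommGroup
  Matrix.frobeniusNormedSpace

lemma aux_exp (t : ℝ) (ht : 0 ≤ t) : 2 * (Real.exp t - 1) ≤ t * (Real.exp t + 1) := by
  have hd : ∀ x : ℝ, HasDerivAt (fun x : ℝ => x * (Real.exp x + 1) - 2 * (Real.exp x - 1))
      (1 * (Real.exp x + 1) + x * Real.exp x - 2 * Real.exp x) x := by
    intro x
    exact ((hasDerivAt_id x).mul ((Real.hasDerivAt_exp x).add_const 1)).sub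
      (((Real.hasDerivAt_exp x).sub_const 1).const_mul 2)
  have hm : Monotone (fun x : ℝ => x * (Real.exp x + 1) - 2 * (Real.exp x - 1)) := by
    apply monotone_of_deriv_nonneg (fun x => (hd x).differentiableAt)
    intro x
    rw [(hd x).deriv]
    have h1 := Real.add_one_le_exp (-x)
    have h2 : Real.exp x * Real.exp (-x) = 1 := by rw [← Real.exp_add]; simp
    nlinarith [Real.exp_pos x, mul_le_mul_of_nonneg_left h1 (Real.exp_pos x).le]
  have := hm ht
  simp at this
  linarith

/-- two-class comparison -/
lemma aux_two (t x y x' y' : ℝ) (ht : 0 ≤ t) (hx : 0 ≤ x) (hy : 0 ≤ y) (hx' : 0 ≤ x')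
    (hy' : 0 ≤ y') (h1 : 0 < x + y) (h2 : 0 < x' + y')
    (hxx : x ≤ Real.exp t * x') (hyy : y' ≤ Real.exp t * y) :
    x / (x + y) - x' / (x' + y') ≤ t / 2 := by
  have hE := aux_exp t ht
  set k := Real.exp t with hk
  have hk1 : 1 ≤ k := Real.one_le_exp ht
  obtain ⟨u, hu0, hu⟩ : ∃ u, 0 ≤ u ∧ u ^ 2 = x * y' :=
    ⟨√(x * y'), Real.sqrt_nonneg _, Real.sq_sqrt (by positivity)⟩
  obtain ⟨v, hv0, hv⟩ : ∃ v, 0 ≤ v ∧ v ^ 2 = x' * y :=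
    ⟨√(x' * y), Real.sqrt_nonneg _, Real.sq_sqrt (by positivity)⟩
  have huv : u ≤ k * v := by
    apply le_of_sq_le_sq _ (by positivity)
    rw [hu, mul_pow, hv]
    calc x * y' ≤ (k * x') * (k * y) := by gcongr
      _ = _ := by ring
  have hprod : (u + v) ^ 2 ≤ (x + y) * (x' + y') := by
    have : u * v * 2 ≤ x * x' + y * y' := by
      apply le_of_sq_le_sq _ (by positivity)
      rw [mul_pow, mul_pow, hu, hv]
      nlinarith [sq_nonneg (x * x' - y * y')]
    nlinarith
  rw [div_sub_div _ _ h1.ne' h2.ne', div_le_iff₀ (by positivity)]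
  have e : x * (x' + y') - (x + y) * x' = u ^ 2 - v ^ 2 := by rw [hu, hv]; ring
  rw [e]
  have h3 : 2 * (u - v) ≤ t * (u + v) := by
    have a1 : (u - v) * (k + 1) ≤ (k - 1) * (u + v) := by nlinarith
    have a2 : 2 * (u - v) * (k + 1) ≤ t * (u + v) * (k + 1) := by
      nlinarith [mul_le_mul_of_nonneg_right hE (add_nonneg hu0 hv0)]
    exact le_of_mul_le_mul_right a2 (by linarith)
  calc u ^ 2 - v ^ 2 = (u - v) * (u + v) := by ring
    _ ≤ t / 2 * (u + v) ^ 2 := by nlinarith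
    _ ≤ _ := by gcongr

lemma aux_softmax {n : ℕ} [Nonempty (Fin n)] (a b : Fin n → ℝ) (t : ℝ) (ht : 0 ≤ t)
    (hab : ∀ j, |a j - b j| ≤ t) :
    ∑ j, |Real.exp (a j) / ∑ k, Real.exp (a k) - Real.exp (b j) / ∑ k, Real.exp (b k)| ≤ t := by
  classical
  set p : Fin n → ℝ := fun j => Real.exp (a j) / ∑ k, Real.exp (a k) with hp
  set q : Fin n → ℝ := fun j => Real.exp (b j) / ∑ k, Real.exp (b k) with hq
  have hA : 0 < ∑ k, Real.exp (a k) :=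
    Finset.sum_pos (fun i _ => Real.exp_pos _) Finset.univ_nonempty
  have hB : 0 < ∑ k, Real.exp (b k) :=
    Finset.sum_pos (fun i _ => Real.exp_pos _) Finset.univ_nonempty
  have hps : ∑ j, p j = 1 := by rw [hp, ← Finset.sum_div, div_self hA.ne']
  have hqs : ∑ j, q j = 1 := by rw [hq, ← Finset.sum_div, div_self hB.ne']
  set S := Finset.univ.filter (fun j => q j ≤ p j) with hS
  have e1 : ∑ j, |p j - q j| = 2 * ∑ j ∈ S, (p j - q j) := by
    have h0 : ∑ j, (|p j - q j| + (p j - q j)) = ∑ j, if q j ≤ p j then 2 * (p j - q j) else 0 := by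
      apply Finset.sum_congr rfl
      intro j _
      split_ifs with h
      · rw [abs_of_nonneg (by linarith)]; ring
      · rw [abs_of_neg (by linarith)]; ring
    rw [Finset.sum_add_distrib, Finset.sum_sub_distrib, hps, hqs, ← Finset.sum_filter,
      ← Finset.mul_sum] at h0
    linarith
  have key := aux_two t (∑ j ∈ S, Real.exp (a j)) (∑ j ∈ Sᶜ, Real.exp (a j))
    (∑ j ∈ S, Real.exp (b j)) (∑ j ∈ Sᶜ, Real.exp (b j)) ht
    (Finset.sum_nonneg fun i _ => (Real.exp_pos _).le)
    (Finset.sum_nonneg fun i _ => (Real.exp_pos _).le)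
    (Finset.sum_nonneg fun i _ => (Real.exp_pos _).le)
    (Finset.sum_nonneg fun i _ => (Real.exp_pos _).le)
    (by rw [Finset.sum_add_sum_compl]; exact hA)
    (by rw [Finset.sum_add_sum_compl]; exact hB)
    (by
      rw [Finset.mul_sum]
      refine Finset.sum_le_sum fun j _ => ?_
      rw [← Real.exp_add, Real.exp_le_exp]
      linarith [(abs_le.1 (hab j)).2])
    (by
      rw [Finset.mul_sum]
      refine Finset.sum_le_sum fun j _ => ?_
      rw [← Real.exp_add, Real.exp_le_exp]
      linarith [(abs_le.1 (hab j)).1])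
  rw [Finset.sum_add_sum_compl, Finset.sum_add_sum_compl, Finset.sum_div, Finset.sum_div,
    ← Finset.sum_sub_distrib] at key
  rw [show (∑ j, |Real.exp (a j) / ∑ k, Real.exp (a k) - Real.exp (b j) / ∑ k, Real.exp (b k)|)
    = ∑ j, |p j - q j| from rfl, e1]
  change ∑ j ∈ S, (p j - q j) ≤ t / 2 at key
  linarith

lemma aux_softmax_sq {n : ℕ} [Nonempty (Fin n)] (a : Fin n → ℝ) (t : ℝ)
    (ha : ∀ j, |a j| ≤ t) :
    ∑ j, (Real.exp (a j) / ∑ k, Real.exp (a k)) ^ 2 ≤ Real.exp t ^ 2 / n := by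
  have hA : 0 < ∑ k, Real.exp (a k) :=
    Finset.sum_pos (fun i _ => Real.exp_pos _) Finset.univ_nonempty
  have hn : (0 : ℝ) < n := by
    have := Fin.pos_iff_nonempty.2 (inferInstance : Nonempty (Fin n))
    exact_mod_cast this
  have hA2 : n * Real.exp (-t) ≤ ∑ k, Real.exp (a k) := by
    calc (n : ℝ) * Real.exp (-t) = ∑ k : Fin n, Real.exp (-t) := by simp
      _ ≤ _ := Finset.sum_le_sum fun j _ => by
        rw [Real.exp_le_exp]; exact (abs_le.1 (ha j)).1
  have hb : ∀ j, Real.exp (a j) / ∑ k, Real.exp (a k) ≤ Real.exp t ^ 2 / n := by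
    intro j
    rw [div_le_div_iff₀ hA hn]
    have h1 : Real.exp (a j) ≤ Real.exp t := Real.exp_le_exp.2 (abs_le.1 (ha j)).2
    have h2 : Real.exp t * Real.exp (-t) = 1 := by rw [← Real.exp_add]; simp
    calc Real.exp (a j) * n ≤ Real.exp t * n := by gcongr
      _ = Real.exp t ^ 2 * (n * Real.exp (-t)) := by
        linear_combination (-(Real.exp t * n)) * h2
      _ ≤ _ := by gcongr
  calc _ ≤ ∑ j, (Real.exp (a j) / ∑ k, Real.exp (a k)) * (Real.exp t ^ 2 / n) := by
        refine Finset.sum_le_sum fun j _ => ?_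
        rw [sq]
        exact mul_le_mul_of_nonneg_left (hb j) (by positivity)
    _ = _ := by rw [← Finset.sum_mul, ← Finset.sum_div, div_self hA.ne', one_mul]

lemma aux_sup {n : ℕ} (v : Fin n → ℝ) : (⨆ j, |v j|) = ‖v‖ := by
  rcases isEmpty_or_nonempty (Fin n) with h | h
  · rw [Real.iSup_of_isEmpty, Pi.norm_def]; simp
  · apply le_antisymm
    · exact ciSup_le fun j => norm_le_pi_norm v j
    · rw [pi_norm_le_iff_of_nonempty]
      exact fun j => le_ciSup (f := fun j => |v j|) (Set.finite_range _).bddAbove j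

lemma norm2Inf_eq {m n : ℕ} (M : Matrix (Fin m) (Fin n) ℝ) :
    norm2Inf M = ‖(WithLp.toLp 2 (fun i => M i) : PiLp 2 (fun _ : Fin m => Fin n → ℝ))‖ := by
  rw [PiLp.norm_eq_of_L2, norm2Inf]
  simp only [aux_sup]

lemma norm2Inf_add {m n : ℕ} (A B : Matrix (Fin m) (Fin n) ℝ) :
    norm2Inf (A + B) ≤ norm2Inf A + norm2Inf B := by
  simp only [norm2Inf_eq]
  exact norm_add_le (WithLp.toLp 2 (fun i => A i) : PiLp 2 (fun _ : Fin m => Fin n → ℝ))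
    (WithLp.toLp 2 (fun i => B i))

lemma norm2Inf_smul {m n : ℕ} (c : ℝ) (A : Matrix (Fin m) (Fin n) ℝ) :
    norm2Inf (c • A) = |c| * norm2Inf A := by
  simp only [norm2Inf_eq]
  exact norm_smul c (WithLp.toLp 2 (fun i => A i) : PiLp 2 (fun _ : Fin m => Fin n → ℝ))

lemma norm2Inf_nonneg {m n : ℕ} (A : Matrix (Fin m) (Fin n) ℝ) : 0 ≤ norm2Inf A :=
  Real.sqrt_nonneg _

lemma norm2Inf_abs_sub {m n : ℕ} (A B : Matrix (Fin m) (Fin n) ℝ) :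
    |norm2Inf A - norm2Inf B| ≤ norm2Inf (A - B) := by
  simp only [norm2Inf_eq]
  exact abs_norm_sub_norm_le
    (WithLp.toLp 2 (fun i => A i) : PiLp 2 (fun _ : Fin m => Fin n → ℝ))
    (WithLp.toLp 2 (fun i => B i))

lemma norm2Inf_entry {m n : ℕ} (A : Matrix (Fin m) (Fin n) ℝ) (i : Fin m) (j : Fin n) :
    |A i j| ≤ norm2Inf A := by
  rw [norm2Inf_eq]
  exact (norm_le_pi_norm (A i) j).trans
    (PiLp.norm_apply_le (WithLp.toLp 2 (fun i => A i) : PiLp 2 (fun _ : Fin m => Fin n → ℝ)) i)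

lemma frobNorm_eq {m n : ℕ} (M : Matrix (Fin m) (Fin n) ℝ) : frobNorm M = ‖M‖ := by
  rw [Matrix.frobenius_norm_def, frobNorm, Real.sqrt_eq_rpow]
  simp

lemma row_le_normInf2 {m n : ℕ} (M : Matrix (Fin m) (Fin n) ℝ) (i : Fin m) :
    Real.sqrt (∑ j, (M i j) ^ 2) ≤ normInf2 M :=
  le_ciSup (f := fun i => Real.sqrt (∑ j, (M i j) ^ 2)) (Set.finite_range _).bddAbove i

lemma normInf2_nonneg {m n : ℕ} (M : Matrix (Fin m) (Fin n) ℝ) : 0 ≤ normInf2 M :=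
  Real.iSup_nonneg fun _ => Real.sqrt_nonneg _

lemma normInf2_le {m n : ℕ} (A B : Matrix (Fin m) (Fin n) ℝ) :
    normInf2 A ≤ normInf2 B + frobNorm (A - B) := by
  have h0 : 0 ≤ normInf2 B + frobNorm (A - B) :=
    add_nonneg (normInf2_nonneg B) (Real.sqrt_nonneg _)
  apply Real.iSup_le _ h0
  intro i
  have e : ∀ C : Matrix (Fin m) (Fin n) ℝ, Real.sqrt (∑ j, (C i j) ^ 2) =
      ‖(WithLp.toLp 2 (C i) : EuclideanSpace ℝ (Fin n))‖ := by
    intro C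
    rw [EuclideanSpace.norm_eq]; simp
  have h1 := norm_le_norm_add_norm_sub' (WithLp.toLp 2 (A i) : EuclideanSpace ℝ (Fin n))
    (WithLp.toLp 2 (B i))
  have h2 := e (A - B)
  change _ = ‖(WithLp.toLp 2 (A i) : EuclideanSpace ℝ (Fin n)) - WithLp.toLp 2 (B i)‖ at h2
  rw [← h2, ← e, ← e] at h1
  refine h1.trans (add_le_add (row_le_normInf2 B i) ?_)
  apply Real.sqrt_le_sqrt
  exact Finset.single_le_sum (f := fun i => ∑ j, ((A - B) i j) ^ 2)
    (fun i _ => Finset.sum_nonneg fun j _ => sq_nonneg _) (Finset.mem_univ i)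

lemma frobNorm_transpose {m n : ℕ} (M : Matrix (Fin m) (Fin n) ℝ) :
    frobNorm Mᵀ = frobNorm M := by
  rw [frobNorm, frobNorm, Finset.sum_comm]; rfl

/-- Frobenius bound for `Y * Dᵀ` from row-wise `ℓ1` bounds on `D`. -/
lemma frob_mul_le {d m n : ℕ} (Y : Matrix (Fin d) (Fin n) ℝ) (D G : Matrix (Fin m) (Fin n) ℝ)
    (h : ∀ i, ∑ j, |D i j| ≤ ⨆ j, |G i j|) :
    frobNorm (Y * Dᵀ) ≤ normInf2 Yᵀ * norm2Inf G := by
  have hN := normInf2_nonneg Yᵀ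
  apply Real.sqrt_le_iff.2
  refine ⟨mul_nonneg hN (norm2Inf_nonneg G), ?_⟩
  rw [mul_pow, norm2Inf, Real.sq_sqrt (Finset.sum_nonneg fun i _ => sq_nonneg _),
    Finset.sum_comm, Finset.mul_sum]
  refine Finset.sum_le_sum fun i _ => ?_
  rw [← mul_pow]
  have e : ∑ a, ((Y * Dᵀ) a i) ^ 2 =
      ‖∑ j, D i j • (WithLp.toLp 2 (Yᵀ j) : EuclideanSpace ℝ (Fin d))‖ ^ 2 := by
    rw [EuclideanSpace.norm_sq_eq]
    refine Finset.sum_congr rfl fun a _ => ?_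
    simp [Matrix.mul_apply, mul_comm]
  rw [e]
  gcongr
  calc _ ≤ ∑ j, ‖D i j • (WithLp.toLp 2 (Yᵀ j) : EuclideanSpace ℝ (Fin d))‖ := norm_sum_le _ _
    _ ≤ ∑ j, |D i j| * normInf2 Yᵀ := by
      refine Finset.sum_le_sum fun j _ => ?_
      rw [norm_smul, Real.norm_eq_abs]
      refine mul_le_mul_of_nonneg_left ?_ (abs_nonneg _)
      refine le_trans (le_of_eq ?_) (row_le_normInf2 Yᵀ j)
      rw [EuclideanSpace.norm_eq]; simp
    _ = normInf2 Yᵀ * ∑ j, |D i j| := by rw [← Finset.sum_mul, mul_comm]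
    _ ≤ _ := by gcongr; exact h i

/-- **LipschitzNorm for Lipschitz scores.** Let `α ≥ 0` and let `g̃` be a
differentiable map that is Lipschitz from the Frobenius norm to the `(2,∞)`-norm with
constant `L > 0`.  With the LipschitzNorm-normalized score
`g(X) = α g̃(X) / max{‖g̃(X)‖_{(2,∞)}, ‖Xᵀ‖_{(∞,2)} L}` (denominator assumed positive),
the attention `Att(X) = X ⬝ softmax(g(X))ᵀ` is Lipschitz for the Frobenius norm with
constant `e^α √(m/n) + α√8`. -/
theorem attention_lipschitz_of_lipschitz_score {d n m : ℕ}
    (α : ℝ) (hα : 0 ≤ α)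
    (gt : Matrix (Fin d) (Fin n) ℝ → Matrix (Fin m) (Fin n) ℝ)
    (hgt : Differentiable ℝ gt)
    (L : ℝ) (hL : 0 < L)
    (hLip : ∀ X Y, norm2Inf (gt X - gt Y) ≤ L * frobNorm (X - Y))
    (hden : ∀ X : Matrix (Fin d) (Fin n) ℝ, 0 < max (norm2Inf (gt X)) (normInf2 Xᵀ * L)) :
    ∀ X Y : Matrix (Fin d) (Fin n) ℝ,
      frobNorm
          (X * (softmaxM ((α / max (norm2Inf (gt X)) (normInf2 Xᵀ * L)) • gt X))ᵀ -
           Y * (softmaxM ((α / max (norm2Inf (gt Y)) (normInf2 Yᵀ * L)) • gt Y))ᵀ) ≤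
        (Real.exp α * Real.sqrt ((m : ℝ) / n) + α * Real.sqrt 8) * frobNorm (X - Y) := by
  intro X Y
  have hne : Nonempty (Fin n) := by
    by_contra hc
    rw [not_nonempty_iff] at hc
    have := hden X
    simp [norm2Inf, normInf2] at this
  have hδ : 0 ≤ frobNorm (X - Y) := Real.sqrt_nonneg _
  have hDX := hden X
  have hDY := hden Y
  have hgX : norm2Inf (gt X) ≤ max (norm2Inf (gt X)) (normInf2 Xᵀ * L) := le_max_left _ _
  have hYD : normInf2 Yᵀ * L ≤ max (norm2Inf (gt Y)) (normInf2 Yᵀ * L) := le_max_right _ _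
  have hDD : |max (norm2Inf (gt Y)) (normInf2 Yᵀ * L) - max (norm2Inf (gt X)) (normInf2 Xᵀ * L)|
      ≤ L * frobNorm (X - Y) := by
    rw [abs_sub_comm]
    refine (abs_max_sub_max_le_max _ _ _ _).trans (max_le ?_ ?_)
    · exact (norm2Inf_abs_sub _ _).trans (hLip X Y)
    · rw [← sub_mul, abs_mul, abs_of_pos hL, mul_comm]
      gcongr
      have h1 := normInf2_le Xᵀ Yᵀ
      have h2 := normInf2_le Yᵀ Xᵀ
      rw [← Matrix.transpose_sub, frobNorm_transpose] at h1 h2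
      have h3 : frobNorm (Y - X) = frobNorm (X - Y) := by
        rw [frobNorm_eq, frobNorm_eq, norm_sub_rev]
      rw [abs_le]
      constructor <;> linarith
  generalize max (norm2Inf (gt X)) (normInf2 Xᵀ * L) = a at *
  generalize max (norm2Inf (gt Y)) (normInf2 Yᵀ * L) = b at *
  set δ := frobNorm (X - Y) with hδd
  -- the bound on the scores
  have hg : norm2Inf ((α / a) • gt X - (α / b) • gt Y) ≤ 2 * α * L * δ / b := by
    have e : (α / a) • gt X - (α / b) • gt Y =
        (α / b) • (gt X - gt Y) + (α / a - α / b) • gt X := by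
      rw [smul_sub, sub_smul]; abel
    rw [e]
    refine (norm2Inf_add _ _).trans ?_
    rw [norm2Inf_smul, norm2Inf_smul, abs_of_nonneg (by positivity : 0 ≤ α / b)]
    have e2 : α / a - α / b = α / b * ((b - a) / a) := by field_simp
    rw [e2, abs_mul, abs_of_nonneg (by positivity : 0 ≤ α / b), abs_div, abs_of_pos hDX]
    have h1 : |b - a| / a * norm2Inf (gt X) ≤ L * δ := by
      calc |b - a| / a * norm2Inf (gt X) ≤ |b - a| / a * a := by gcongr
        _ = |b - a| := by field_simp
        _ ≤ _ := hDD
    calc _ = α / b * (norm2Inf (gt X - gt Y) + |b - a| / a * norm2Inf (gt X)) := by ring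
      _ ≤ α / b * (L * δ + L * δ) := by gcongr; exact hLip X Y
      _ = _ := by ring
  have hgX' : norm2Inf ((α / a) • gt X) ≤ α := by
    rw [norm2Inf_smul, abs_of_nonneg (by positivity : 0 ≤ α / a)]
    calc _ ≤ α / a * a := by gcongr
      _ = α := by field_simp
  generalize (α / a) • gt X = G at *
  generalize (α / b) • gt Y = H at *
  have e : X * (softmaxM G)ᵀ - Y * (softmaxM H)ᵀ =
      (X - Y) * (softmaxM G)ᵀ + Y * (softmaxM G - softmaxM H)ᵀ := by
    rw [Matrix.transpose_sub, Matrix.sub_mul, Matrix.mul_sub]; abel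
  have hS : frobNorm (softmaxM G)ᵀ ≤ Real.exp α * Real.sqrt ((m : ℝ) / n) := by
    rw [frobNorm_transpose]
    apply Real.sqrt_le_iff.2
    refine ⟨by positivity, ?_⟩
    rw [mul_pow, Real.sq_sqrt (by positivity)]
    calc _ ≤ ∑ i : Fin m, Real.exp α ^ 2 / n :=
          Finset.sum_le_sum fun i _ => aux_softmax_sq (G i) α
            fun j => (norm2Inf_entry G i j).trans hgX'
      _ = _ := by simp; ring
  have h2 : frobNorm (Y * (softmaxM G - softmaxM H)ᵀ) ≤ normInf2 Yᵀ * norm2Inf (G - H) := by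
    apply frob_mul_le
    intro i
    have hle : ∀ j, |G i j - H i j| ≤ ⨆ j, |(G - H) i j| := fun j =>
      le_ciSup (f := fun j => |(G - H) i j|) (Set.finite_range _).bddAbove j
    exact aux_softmax (G i) (H i) _ (Real.iSup_nonneg fun _ => abs_nonneg _) hle
  have h3 : normInf2 Yᵀ * norm2Inf (G - H) ≤ α * Real.sqrt 8 * δ := by
    have h8 : 2 ≤ Real.sqrt 8 := Real.le_sqrt_of_sq_le (by norm_num)
    calc _ ≤ normInf2 Yᵀ * (2 * α * L * δ / b) :=
          mul_le_mul_of_nonneg_left hg (normInf2_nonneg _)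
      _ = (normInf2 Yᵀ * L) / b * (α * 2 * δ) := by ring
      _ ≤ 1 * (α * 2 * δ) := by
          gcongr
          exact (div_le_one hDY).2 hYD
      _ ≤ _ := by rw [one_mul]; gcongr
  have h1 : frobNorm ((X - Y) * (softmaxM G)ᵀ) ≤ δ * frobNorm (softmaxM G)ᵀ := by
    rw [hδd, frobNorm_eq, frobNorm_eq, frobNorm_eq]
    exact Matrix.frobenius_norm_mul _ _
  rw [e]
  calc _ ≤ frobNorm ((X - Y) * (softmaxM G)ᵀ) + frobNorm (Y * (softmaxM G - softmaxM H)ᵀ) := by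
        simp only [frobNorm_eq]
        exact norm_add_le _ _
    _ ≤ δ * (Real.exp α * Real.sqrt ((m : ℝ) / n)) + α * Real.sqrt 8 * δ := by
        refine add_le_add (h1.trans ?_) (h2.trans h3)
        gcongr
    _ = _ := by ring
end
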